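/- arXiv:1105.5756 — 3 statements merged into one kernel-verified Lean document; each statement's English description precedes it below -/
import Mathlib

section
/- Let K be any field and let M be an n×n matrix over K. If M lies in the Kalman variety K_{s,d,n}, i.e., there exists a K-subspace U ⊆ L with dim_K U = s and M(U) ⊆ U, then the reduced Kalman matrix R(M) has rank at most d − s; equivalently, every (d−s+1)×(d−s+1) minor of R(M) vanishes. -/
open Matrix

/-- The span of the first `d` standard basis vectors of `K^n`. -/
def firstCoordsSubspace (K : Type*) [Field K] (n d : ℕ) : Submodule K (Fin n → K) where
  carrier := {v | ∀ i : Fin n, d ≤ (i : ℕ) → v i = 0}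
  add_mem' := fun hv hw i hi => by simp [hv i hi, hw i hi]
  zero_mem' := fun i _ => rfl
  smul_mem' := fun c v hv i hi => by simp [hv i hi]

/-- The Kalman variety `K_{s,d,n}`: matrices having an `s`-dimensional invariant
subspace contained in the span `L` of the first `d` standard basis vectors. -/
def kalmanSet (K : Type*) [Field K] (n d s : ℕ) : Set (Matrix (Fin n) (Fin n) K) :=
  {M | ∃ U : Submodule K (Fin n → K), U ≤ firstCoordsSubspace K n d ∧
    Module.finrank K U = s ∧ ∀ v ∈ U, M.mulVec v ∈ U}

/-- The upper-left `d × d` block `α` of an `n × n` matrix. -/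
def alphaBlock {K : Type*} [Field K] {n : ℕ} (d : ℕ) (h : d ≤ n)
    (M : Matrix (Fin n) (Fin n) K) : Matrix (Fin d) (Fin d) K :=
  fun i j => M (Fin.castLE h i) (Fin.castLE h j)

/-- The lower-left `(n-d) × d` block `γ` of an `n × n` matrix. -/
def gammaBlock {K : Type*} [Field K] {n : ℕ} (d : ℕ) (h : d ≤ n)
    (M : Matrix (Fin n) (Fin n) K) : Matrix (Fin (n - d)) (Fin d) K :=
  fun i j => M ⟨d + (i : ℕ), by have := i.isLt; omega⟩ (Fin.castLE h j)

/-- The reduced Kalman matrix: the `d(n-d) × d` matrix obtained by stacking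
`γ, γα, γα², …, γα^{d-1}`; row `(k, i)` is row `i` of the block `γ * α^k`. -/
def redKalman {K : Type*} [Field K] {n : ℕ} (d : ℕ) (h : d ≤ n)
    (M : Matrix (Fin n) (Fin n) K) : Matrix (Fin d × Fin (n - d)) (Fin d) K :=
  fun p j => (gammaBlock d h M * (alphaBlock d h M) ^ (p.1 : ℕ)) p.2 j

theorem sum_firstCoords {K : Type*} [Field K] {n d : ℕ} (h : d ≤ n) {v : Fin n → K}
    (hv : v ∈ firstCoordsSubspace K n d) (f : Fin n → K) :
    ∑ j, f j * v j = ∑ j : Fin d, f (Fin.castLE h j) * v (Fin.castLE h j) := by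
  symm
  refine Finset.sum_of_injOn (Fin.castLE h) (Fin.castLE_injective h).injOn (by simp) ?_ (by simp)
  intro i _ hi
  have hdi : d ≤ (i : ℕ) := by
    by_contra! hlt
    exact hi ⟨⟨i, hlt⟩, by simp, rfl⟩
  rw [hv i hdi, mul_zero]

theorem alphaBlock_mulVec_comp_castLE {K : Type*} [Field K] {n d : ℕ} (h : d ≤ n)
    (M : Matrix (Fin n) (Fin n) K) {v : Fin n → K} (hv : v ∈ firstCoordsSubspace K n d) :
    alphaBlock d h M *ᵥ (v ∘ Fin.castLE h) = (M *ᵥ v) ∘ Fin.castLE h := by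
  ext i
  exact (sum_firstCoords h hv (M (Fin.castLE h i))).symm

theorem gammaBlock_mulVec_comp_castLE {K : Type*} [Field K] {n d : ℕ} (h : d ≤ n)
    (M : Matrix (Fin n) (Fin n) K) {v : Fin n → K} (hv : v ∈ firstCoordsSubspace K n d)
    (hMv : M *ᵥ v ∈ firstCoordsSubspace K n d) :
    gammaBlock d h M *ᵥ (v ∘ Fin.castLE h) = 0 := by
  ext i
  have hi : d + (i : ℕ) < n := by have := i.isLt; omega
  exact (sum_firstCoords h hv (M ⟨d + (i : ℕ), hi⟩)).symm.trans (hMv ⟨d + i, hi⟩ (by simp))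

theorem redKalman_mulVec_comp_castLE {K : Type*} [Field K] {n d : ℕ} (h : d ≤ n)
    (M : Matrix (Fin n) (Fin n) K) {U : Submodule K (Fin n → K)}
    (hU : U ≤ firstCoordsSubspace K n d) (hMU : ∀ v ∈ U, M *ᵥ v ∈ U)
    {v : Fin n → K} (hv : v ∈ U) :
    redKalman d h M *ᵥ (v ∘ Fin.castLE h) = 0 := by
  have key : ∀ (k : ℕ) (v : Fin n → K), v ∈ U →
      (gammaBlock d h M * alphaBlock d h M ^ k) *ᵥ (v ∘ Fin.castLE h) = 0 := by
    intro k
    induction k with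
    | zero =>
      intro v hv
      rw [pow_zero, Matrix.mul_one]
      exact gammaBlock_mulVec_comp_castLE h M (hU hv) (hU (hMU v hv))
    | succ k ih =>
      intro v hv
      rw [pow_succ, ← Matrix.mul_assoc, ← Matrix.mulVec_mulVec,
        alphaBlock_mulVec_comp_castLE h M (hU hv)]
      exact ih _ (hMU v hv)
  ext p
  exact congrFun (key p.1 v hv) p.2

theorem rank_redKalman_le {K : Type*} [Field K] {n d : ℕ} (h : d ≤ n)
    (M : Matrix (Fin n) (Fin n) K) {U : Submodule K (Fin n → K)}
    (hU : U ≤ firstCoordsSubspace K n d) (hMU : ∀ v ∈ U, M *ᵥ v ∈ U) :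
    (redKalman d h M).rank ≤ d - Module.finrank K U := by
  let f : U →ₗ[K] LinearMap.ker (redKalman d h M).mulVecLin :=
    ((LinearMap.funLeft K K (Fin.castLE h)).comp U.subtype).codRestrict _ fun v =>
      redKalman_mulVec_comp_castLE h M hU hMU v.2
  have hf : Function.Injective f := by
    intro v w hvw
    ext i
    by_cases hi : (i : ℕ) < d
    · exact congrFun (congrArg Subtype.val hvw) ⟨i, hi⟩
    · rw [hU v.2 i (not_lt.mp hi), hU w.2 i (not_lt.mp hi)]
  have hker := LinearMap.finrank_le_finrank_of_injective hf
  have hrn := (redKalman d h M).mulVecLin.finrank_range_add_finrank_ker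
  rw [Module.finrank_fin_fun] at hrn
  rw [Matrix.rank]
  omega

theorem det_submatrix_eq_zero_of_rank_lt {K m n ι : Type*} [Field K] [Fintype m] [Fintype n]
    [Fintype ι] [DecidableEq ι] (A : Matrix m n K) (r : ι → m) (c : ι → n)
    (hA : A.rank < Fintype.card ι) : (A.submatrix r c).det = 0 := by
  by_contra hdet
  have hrank := Matrix.rank_of_isUnit _ ((Matrix.isUnit_iff_isUnit_det _).mpr (Ne.isUnit hdet))
  have hle := Matrix.rank_submatrix_le A r c
  omega

theorem stmt0 (K : Type*) [Field K] (n d s : ℕ) (hd : 1 ≤ d) (hdn : d < n)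
    (hs : 1 ≤ s) (hsd : s ≤ d) (M : Matrix (Fin n) (Fin n) K)
    (hM : M ∈ kalmanSet K n d s) :
    (redKalman d hdn.le M).rank ≤ d - s ∧
    ∀ (r : Fin (d - s + 1) → Fin d × Fin (n - d)) (c : Fin (d - s + 1) → Fin d),
      Function.Injective r → Function.Injective c →
        ((redKalman d hdn.le M).submatrix r c).det = 0 := by
  obtain ⟨U, hU, rfl, hMU⟩ := hM
  have hrank := rank_redKalman_le hdn.le M hU hMU
  refine ⟨hrank, fun r c _ _ => det_submatrix_eq_zero_of_rank_lt _ r c ?_⟩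
  rw [Fintype.card_fin]
  exact Nat.lt_succ_of_le hrank
end

section
/- Let K be any field and M an n×n matrix over K. Let N = {v ∈ L : R(M)·v̄ = 0}, where v̄ ∈ K^d denotes the vector of the first d coordinates of v (the coordinates of v with respect to the chosen basis of L). Then: (i) M(N) ⊆ N; (ii) every K-subspace U of K^n with U ⊆ L and M(U) ⊆ U satisfies U ⊆ N (so N is the largest M-invariant subspace of K^n contained in L); and (iii) dim_K N = d − rank R(M). -/
open Matrix

/-- The powers of `A` below `d` span all powers, by Cayley–Hamilton. -/
theorem mul_pow_mulVec_eq_zero {K m : Type*} [Field K] {d : ℕ} (C : Matrix m (Fin d) K)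
    (A : Matrix (Fin d) (Fin d) K) (w : Fin d → K)
    (h : ∀ k < d, (C * A ^ k) *ᵥ w = 0) (k : ℕ) : (C * A ^ k) *ᵥ w = 0 := by
  rcases Nat.eq_zero_or_pos d with rfl | hd
  · rw [Subsingleton.elim w 0, mulVec_zero]
  have hdeg : (Polynomial.X ^ k %ₘ A.charpoly).natDegree < d := by
    have hA : A.charpoly.natDegree = d := by simp
    have hone : A.charpoly ≠ 1 := by
      intro h1
      rw [h1, Polynomial.natDegree_one] at hA
      omega
    simpa using Polynomial.natDegree_modByMonic_lt (Polynomial.X ^ k) A.charpoly_monic hone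
  rw [Matrix.pow_eq_aeval_mod_charpoly, Polynomial.aeval_eq_sum_range' hdeg, Matrix.mul_sum,
    Matrix.sum_mulVec]
  refine Finset.sum_eq_zero fun i hi => ?_
  rw [Matrix.mul_smul, Matrix.smul_mulVec, h i (Finset.mem_range.mp hi), smul_zero]

theorem redKalman_mulVec_eq_zero_iff {K : Type*} [Field K] {n d : ℕ} (h : d ≤ n)
    (M : Matrix (Fin n) (Fin n) K) (w : Fin d → K) :
    redKalman d h M *ᵥ w = 0 ↔
      ∀ k : ℕ, (gammaBlock d h M * alphaBlock d h M ^ k) *ᵥ w = 0 := by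
  refine ⟨fun hw => mul_pow_mulVec_eq_zero _ _ _ fun k hk => ?_, fun hw => ?_⟩
  · ext i
    exact congrFun hw (⟨k, hk⟩, i)
  · ext p
    exact congrFun (hw p.1) p.2

theorem mulVec_apply_of_mem_firstCoordsSubspace {K : Type*} [Field K] {n d : ℕ} (h : d ≤ n)
    (M : Matrix (Fin n) (Fin n) K) {v : Fin n → K} (hv : v ∈ firstCoordsSubspace K n d)
    (i : Fin n) : (M *ᵥ v) i = ∑ j : Fin d, M i (Fin.castLE h j) * v (Fin.castLE h j) := by
  refine (Fintype.sum_of_injective (Fin.castLE h) (Fin.castLE_injective h) _ _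
    (fun j hj => ?_) fun _ => rfl).symm
  have hdj : d ≤ (j : ℕ) := by
    by_contra hlt
    exact hj ⟨⟨j, by omega⟩, rfl⟩
  rw [hv j hdj, mul_zero]

theorem mulVec_comp_castLE {K : Type*} [Field K] {n d : ℕ} (h : d ≤ n)
    (M : Matrix (Fin n) (Fin n) K) {v : Fin n → K} (hv : v ∈ firstCoordsSubspace K n d) :
    (M *ᵥ v) ∘ Fin.castLE h = alphaBlock d h M *ᵥ (v ∘ Fin.castLE h) :=
  funext fun i => mulVec_apply_of_mem_firstCoordsSubspace h M hv (Fin.castLE h i)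

theorem mulVec_mem_firstCoordsSubspace_iff {K : Type*} [Field K] {n d : ℕ} (h : d ≤ n)
    (M : Matrix (Fin n) (Fin n) K) {v : Fin n → K} (hv : v ∈ firstCoordsSubspace K n d) :
    M *ᵥ v ∈ firstCoordsSubspace K n d ↔ gammaBlock d h M *ᵥ (v ∘ Fin.castLE h) = 0 := by
  refine ⟨fun hM => funext fun i => ?_, fun hg i hi => ?_⟩
  · exact (mulVec_apply_of_mem_firstCoordsSubspace h M hv _).symm.trans
      (hM ⟨d + i, by omega⟩ (Nat.le_add_right _ _))
  · obtain ⟨i, hin⟩ := i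
    obtain ⟨k, rfl⟩ := Nat.exists_eq_add_of_le hi
    exact (mulVec_apply_of_mem_firstCoordsSubspace h M hv _).trans
      (congrFun hg ⟨k, by omega⟩)

theorem finrank_firstCoordsSubspace_inf_ker {K V : Type*} [Field K] [AddCommGroup V]
    [Module K V] {n d : ℕ} (h : d ≤ n) (f : (Fin d → K) →ₗ[K] V) :
    Module.finrank K ↥(firstCoordsSubspace K n d ⊓
      LinearMap.ker (f ∘ₗ LinearMap.funLeft K K (Fin.castLE h))) =
      Module.finrank K (LinearMap.ker f) := by
  have hinj := Fin.castLE_injective h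
  have hext : ∀ w : Fin d → K, (Function.extend (Fin.castLE h) w 0) ∘ Fin.castLE h = w :=
    fun w => Function.extend_comp hinj w 0
  have hmap : firstCoordsSubspace K n d ⊓
      LinearMap.ker (f ∘ₗ LinearMap.funLeft K K (Fin.castLE h)) =
      (LinearMap.ker f).map (Function.ExtendByZero.linearMap K (Fin.castLE h)) := by
    ext v
    constructor
    · rintro ⟨hv, hf⟩
      refine ⟨v ∘ Fin.castLE h, hf, funext fun i => ?_⟩
      by_cases hi : (i : ℕ) < d
      · exact hinj.extend_apply (v ∘ Fin.castLE h) 0 ⟨i, hi⟩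
      · refine (Function.extend_apply' _ _ _ ?_).trans (hv i (not_lt.mp hi)).symm
        rintro ⟨j, rfl⟩
        exact hi j.isLt
    · rintro ⟨w, hw, rfl⟩
      refine ⟨fun i hi => Function.extend_apply' _ _ _ ?_, ?_⟩
      · rintro ⟨j, rfl⟩
        exact absurd j.isLt (not_lt.mpr hi)
      · exact (congrArg f (hext w)).trans hw
  rw [hmap]
  refine (Submodule.equivMapOfInjective _ (fun w w' hww => ?_) _).finrank_eq.symm
  rw [← hext w, ← hext w']
  exact congrArg (· ∘ Fin.castLE h) hww

theorem stmt1 (K : Type*) [Field K] (n d : ℕ) (hd : 1 ≤ d) (hdn : d < n)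
    (M : Matrix (Fin n) (Fin n) K)
    (N : Submodule K (Fin n → K))
    (hN : N = firstCoordsSubspace K n d ⊓
      LinearMap.ker ((redKalman d hdn.le M).mulVecLin ∘ₗ
        LinearMap.funLeft K K (Fin.castLE hdn.le))) :
    (∀ v ∈ N, M.mulVec v ∈ N) ∧
    (∀ U : Submodule K (Fin n → K), U ≤ firstCoordsSubspace K n d →
      (∀ v ∈ U, M.mulVec v ∈ U) → U ≤ N) ∧
    Module.finrank K N = d - (redKalman d hdn.le M).rank := by
  have hmem : ∀ v, v ∈ N ↔ v ∈ firstCoordsSubspace K n d ∧ ∀ k : ℕ,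
      (gammaBlock d hdn.le M * alphaBlock d hdn.le M ^ k) *ᵥ (v ∘ Fin.castLE hdn.le) = 0 := by
    intro v
    rw [hN, ← redKalman_mulVec_eq_zero_iff]
    rfl
  refine ⟨fun v hv => ?_, fun U hUL hU u hu => ?_, ?_⟩
  · obtain ⟨hvL, hk⟩ := (hmem v).mp hv
    refine (hmem _).mpr ⟨(mulVec_mem_firstCoordsSubspace_iff hdn.le M hvL).mpr ?_, fun k => ?_⟩
    · simpa using hk 0
    · rw [mulVec_comp_castLE hdn.le M hvL, mulVec_mulVec, Matrix.mul_assoc, ← pow_succ]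
      exact hk (k + 1)
  · refine (hmem u).mpr ⟨hUL hu, fun k => ?_⟩
    induction k generalizing u with
    | zero =>
      simpa using (mulVec_mem_firstCoordsSubspace_iff hdn.le M (hUL hu)).mp (hUL (hU u hu))
    | succ k ih =>
      rw [pow_succ, ← Matrix.mul_assoc, ← mulVec_mulVec, ← mulVec_comp_castLE hdn.le M (hUL hu)]
      exact ih _ (hU u hu)
  · have hrank := (redKalman d hdn.le M).mulVecLin.finrank_range_add_finrank_ker
    rw [Module.finrank_fin_fun] at hrank
    rw [hN, finrank_firstCoordsSubspace_inf_ker, Matrix.rank]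
    omega
end

section
/- Let K be an algebraically closed field and 1 ≤ s ≤ d < n. For an n×n matrix M over K, the following are equivalent: (a) M lies in the Kalman variety K_{s,d,n}, i.e., there is a K-subspace U ⊆ L with dim_K U = s and M(U) ⊆ U; (b) the reduced Kalman matrix R(M) has rank at most d − s; (c) every (d−s+1)×(d−s+1) minor of R(M) vanishes. In particular, K_{s,d,n} is the zero locus of the (d−s+1)×(d−s+1) minors of the reduced Kalman matrix. -/
open Matrix

open Polynomial in
/-- By Cayley–Hamilton, a vector killed by `C * A ^ k` for all `k < d` is killed by `C * A ^ k`
for every `k`. -/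
theorem mulVec_pow_eq_zero_of_forall_lt {K m : Type*} [Field K] {d : ℕ} (C : Matrix m (Fin d) K)
    (A : Matrix (Fin d) (Fin d) K) (v : Fin d → K)
    (h : ∀ k < d, (C * A ^ k).mulVec v = 0) (k : ℕ) : (C * A ^ k).mulVec v = 0 := by
  rcases Nat.eq_zero_or_pos d with rfl | hd
  · rw [Subsingleton.elim v 0, Matrix.mulVec_zero]
  have hdeg : A.charpoly.natDegree = d := by simp
  have hlt : (X ^ k %ₘ A.charpoly).natDegree < d := by
    conv_rhs => rw [← hdeg]
    refine natDegree_modByMonic_lt _ A.charpoly_monic fun h1 => ?_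
    rw [h1, natDegree_one] at hdeg
    omega
  rw [A.pow_eq_aeval_mod_charpoly, aeval_eq_sum_range' hlt, Matrix.mul_sum, Matrix.sum_mulVec]
  refine Finset.sum_eq_zero fun i hi => ?_
  rw [Matrix.mul_smul, Matrix.smul_mulVec, h i (Finset.mem_range.mp hi), smul_zero]

/-- Over an algebraically closed field, an endomorphism has invariant subspaces of every
dimension. -/
theorem Module.End.exists_invariant_finrank_eq {K V : Type*} [Field K] [IsAlgClosed K]
    [AddCommGroup V] [Module K V] [FiniteDimensional K V] (f : Module.End K V) {k : ℕ}
    (hk : k ≤ Module.finrank K V) :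
    ∃ U : Submodule K V, Module.finrank K U = k ∧ ∀ v ∈ U, f v ∈ U := by
  induction k with
  | zero => exact ⟨⊥, by simp, by simp⟩
  | succ k ih =>
    obtain ⟨U, hU, hf⟩ := ih (by omega)
    have hq := U.finrank_quotient_add_finrank
    have : Nontrivial (V ⧸ U) := Module.nontrivial_of_finrank_pos (R := K) (by omega)
    obtain ⟨μ, hμ⟩ := Module.End.exists_eigenvalue (U.mapQ U f hf)
    obtain ⟨w, hw⟩ := hμ.exists_hasEigenvector
    refine ⟨(Submodule.span K {w}).comap U.mkQ, ?_, fun v hv => ?_⟩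
    · have h1 := LinearMap.finrank_range_add_finrank_ker
        (U.mkQ.domRestrict ((Submodule.span K {w}).comap U.mkQ))
      rw [LinearMap.range_domRestrict, Submodule.map_comap_eq_of_surjective U.mkQ_surjective,
        finrank_span_singleton hw.2, LinearMap.ker_domRestrict, Submodule.ker_mkQ,
        (Submodule.comapSubtypeEquivOfLe (U.le_comap_mkQ _)).finrank_eq, hU] at h1
      omega
    · rw [Submodule.mem_comap, Submodule.mem_span_singleton] at hv ⊢
      obtain ⟨c, hc⟩ := hv
      refine ⟨c * μ, ?_⟩
      have : U.mkQ (f v) = U.mapQ U f hf (U.mkQ v) := rfl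
      rw [this, ← hc, map_smul, hw.apply_eq_smul, smul_smul]

/-- A version of `Module.End.exists_invariant_finrank_eq` inside a given invariant subspace. -/
theorem Module.End.exists_invariant_le_finrank_eq {K V : Type*} [Field K] [IsAlgClosed K]
    [AddCommGroup V] [Module K V] [FiniteDimensional K V] (f : Module.End K V)
    (W : Submodule K V) (hW : ∀ v ∈ W, f v ∈ W) {k : ℕ} (hk : k ≤ Module.finrank K W) :
    ∃ U ≤ W, Module.finrank K U = k ∧ ∀ v ∈ U, f v ∈ U := by
  obtain ⟨U, hU, hf⟩ := Module.End.exists_invariant_finrank_eq (f.restrict hW) hk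
  refine ⟨U.map W.subtype, Submodule.map_subtype_le W U, ?_, ?_⟩
  · rw [Submodule.finrank_map_subtype_eq, hU]
  · rintro _ ⟨u, hu, rfl⟩
    exact ⟨_, hf u hu, rfl⟩

theorem Matrix.exists_injective_linearIndependent_row {K m n : Type*} [Field K] [Finite m]
    [Fintype n] (A : Matrix m n K) {k : ℕ} (hk : k ≤ A.rank) :
    ∃ r : Fin k → m, Function.Injective r ∧ LinearIndependent K (A.submatrix r id).row := by
  rw [A.rank_eq_finrank_span_row] at hk
  obtain ⟨f, hf, -, hli⟩ := Submodule.exists_fun_fin_finrank_span_eq K (Set.range A.row)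
  choose g hg using hf
  have hli' := hli.comp _ (Fin.castLE_injective hk)
  have heq : (A.submatrix (g ∘ Fin.castLE hk) id).row = f ∘ Fin.castLE hk :=
    funext fun i => hg _
  refine ⟨g ∘ Fin.castLE hk, fun i j hij => hli'.injective ?_, heq ▸ hli'⟩
  simp only [Function.comp_apply] at hij ⊢
  rw [← hg, ← hg, hij]

/-- A matrix over a field has rank less than `k` iff all its `k × k` minors vanish. -/
theorem Matrix.rank_lt_iff_forall_det_submatrix_eq_zero {K m n : Type*} [Field K] [Fintype m]
    [Fintype n] (A : Matrix m n K) (k : ℕ) :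
    A.rank < k ↔ ∀ (r : Fin k → m) (c : Fin k → n), Function.Injective r → Function.Injective c →
      (A.submatrix r c).det = 0 := by
  constructor
  · intro h r c _ _
    by_contra hdet
    have h1 := A.rank_submatrix_le r c
    rw [Matrix.rank_of_det_ne_zero hdet, Fintype.card_fin] at h1
    omega
  · intro h
    by_contra! hk
    obtain ⟨r, hr, hrow⟩ := A.exists_injective_linearIndependent_row hk
    have hrank : k ≤ (A.submatrix r id)ᵀ.rank := by
      rw [Matrix.rank_transpose, hrow.rank_matrix, Fintype.card_fin]
    obtain ⟨c, hc, hcol⟩ := (A.submatrix r id)ᵀ.exists_injective_linearIndependent_row hrank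
    have hunit := Matrix.linearIndependent_rows_iff_isUnit.mp hcol
    rw [Matrix.isUnit_iff_isUnit_det, ← Matrix.det_transpose] at hunit
    exact hunit.ne_zero (h r c hr hc)

/-- Extension of a vector by zero, as a linear map from `K^d` to `K^n`. -/
def zeroExtend (K : Type*) [Field K] (d n : ℕ) : (Fin d → K) →ₗ[K] (Fin n → K) where
  toFun v i := if h : (i : ℕ) < d then v ⟨i, h⟩ else 0
  map_add' v w := by ext i; by_cases h : (i : ℕ) < d <;> simp [h]
  map_smul' c v := by ext i; by_cases h : (i : ℕ) < d <;> simp [h]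

section zeroExtend

variable {K : Type*} [Field K] {n d : ℕ}

theorem zeroExtend_castLE (h : d ≤ n) (v : Fin d → K) (i : Fin d) :
    zeroExtend K d n v (Fin.castLE h i) = v i := by
  simp [zeroExtend]

theorem zeroExtend_of_le (v : Fin d → K) {i : Fin n} (hi : d ≤ (i : ℕ)) :
    zeroExtend K d n v i = 0 := by
  simp [zeroExtend, hi]

theorem zeroExtend_injective (h : d ≤ n) : Function.Injective (zeroExtend K d n) :=
  fun v w hvw => funext fun i => by
    rw [← zeroExtend_castLE h v, ← zeroExtend_castLE h w, hvw]

theorem firstCoordsSubspace_le_range_zeroExtend (h : d ≤ n) :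
    firstCoordsSubspace K n d ≤ LinearMap.range (zeroExtend K d n) := by
  intro u hu
  refine ⟨fun i => u (Fin.castLE h i), funext fun i => ?_⟩
  rcases lt_or_ge (i : ℕ) d with hi | hi
  · exact zeroExtend_castLE h _ ⟨i, hi⟩
  · rw [zeroExtend_of_le _ hi, hu i hi]

theorem mulVec_zeroExtend_apply (h : d ≤ n) (M : Matrix (Fin n) (Fin n) K) (v : Fin d → K)
    (i : Fin n) : M.mulVec (zeroExtend K d n v) i = ∑ j, M i (Fin.castLE h j) * v j := by
  refine (Fintype.sum_of_injective (Fin.castLE h) (Fin.castLE_injective h) _ _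
    (fun j hj => ?_) fun j => by rw [zeroExtend_castLE]).symm
  rw [zeroExtend_of_le, mul_zero]
  by_contra! hlt
  exact hj ⟨⟨j, hlt⟩, rfl⟩

theorem mulVec_zeroExtend_castLE (h : d ≤ n) (M : Matrix (Fin n) (Fin n) K) (v : Fin d → K)
    (i : Fin d) :
    M.mulVec (zeroExtend K d n v) (Fin.castLE h i) = (alphaBlock d h M).mulVec v i :=
  mulVec_zeroExtend_apply h M v _

theorem mulVec_zeroExtend_mem_iff (h : d ≤ n) (M : Matrix (Fin n) (Fin n) K) (v : Fin d → K) :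
    M.mulVec (zeroExtend K d n v) ∈ firstCoordsSubspace K n d ↔
      (gammaBlock d h M).mulVec v = 0 := by
  constructor
  · intro hv
    ext i
    exact (mulVec_zeroExtend_apply h M v _).symm.trans (hv ⟨d + i, by omega⟩ (Nat.le_add_right _ _))
  · intro hv i hi
    obtain ⟨j, hj⟩ := Nat.exists_eq_add_of_le hi
    have hij : i = ⟨d + j, by omega⟩ := Fin.ext hj
    rw [hij]
    exact (mulVec_zeroExtend_apply h M v _).trans (congrFun hv ⟨j, by omega⟩)

theorem mulVec_zeroExtend_eq (h : d ≤ n) (M : Matrix (Fin n) (Fin n) K) {v : Fin d → K}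
    (hv : M.mulVec (zeroExtend K d n v) ∈ firstCoordsSubspace K n d) :
    M.mulVec (zeroExtend K d n v) = zeroExtend K d n ((alphaBlock d h M).mulVec v) := by
  ext i
  rcases lt_or_ge (i : ℕ) d with hi | hi
  · exact (mulVec_zeroExtend_castLE h M v ⟨i, hi⟩).trans (zeroExtend_castLE h _ ⟨i, hi⟩).symm
  · rw [zeroExtend_of_le _ hi, hv i hi]

theorem mem_kalmanSet_iff (h : d ≤ n) (M : Matrix (Fin n) (Fin n) K) (s : ℕ) :
    M ∈ kalmanSet K n d s ↔ ∃ U : Submodule K (Fin d → K), Module.finrank K U = s ∧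
      (∀ v ∈ U, (alphaBlock d h M).mulVec v ∈ U) ∧ ∀ v ∈ U, (gammaBlock d h M).mulVec v = 0 := by
  constructor
  · rintro ⟨U, hUL, hU, hM⟩
    refine ⟨U.comap (zeroExtend K d n), ?_, fun v hv => ?_, fun v hv => ?_⟩
    · rw [(Submodule.equivMapOfInjective _ (zeroExtend_injective h) _).finrank_eq,
        Submodule.map_comap_eq_of_le (hUL.trans (firstCoordsSubspace_le_range_zeroExtend h)), hU]
    · rw [Submodule.mem_comap, ← mulVec_zeroExtend_eq h M (hUL (hM _ hv))]
      exact hM _ hv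
    · exact (mulVec_zeroExtend_mem_iff h M v).mp (hUL (hM _ hv))
  · rintro ⟨U, hU, hα, hγ⟩
    refine ⟨U.map (zeroExtend K d n), ?_, ?_, ?_⟩
    · rintro _ ⟨v, -, rfl⟩ i hi
      exact zeroExtend_of_le v hi
    · rw [← (Submodule.equivMapOfInjective _ (zeroExtend_injective h) U).finrank_eq, hU]
    · rintro _ ⟨v, hv, rfl⟩
      rw [mulVec_zeroExtend_eq h M ((mulVec_zeroExtend_mem_iff h M v).mpr (hγ v hv))]
      exact ⟨_, hα v hv, rfl⟩

end zeroExtend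

theorem mem_ker_redKalman_iff {K : Type*} [Field K] {n d : ℕ} (h : d ≤ n)
    (M : Matrix (Fin n) (Fin n) K) (v : Fin d → K) :
    v ∈ LinearMap.ker (redKalman d h M).mulVecLin ↔
      ∀ k, (gammaBlock d h M * alphaBlock d h M ^ k).mulVec v = 0 := by
  rw [LinearMap.mem_ker, Matrix.mulVecLin_apply]
  constructor
  · intro hv
    refine mulVec_pow_eq_zero_of_forall_lt _ _ v fun k hk => funext fun i => ?_
    exact congrFun hv (⟨k, hk⟩, i)
  · intro hv
    ext p
    exact congrFun (hv p.1) p.2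

theorem mem_kalmanSet_iff_rank_le {K : Type*} [Field K] [IsAlgClosed K] {n d s : ℕ}
    (hsd : s ≤ d) (h : d ≤ n) (M : Matrix (Fin n) (Fin n) K) :
    M ∈ kalmanSet K n d s ↔ (redKalman d h M).rank ≤ d - s := by
  have hrank := LinearMap.finrank_range_add_finrank_ker (redKalman d h M).mulVecLin
  rw [Module.finrank_fin_fun, ← Matrix.rank] at hrank
  rw [mem_kalmanSet_iff h]
  constructor
  · rintro ⟨U, hU, hα, hγ⟩
    have hpow : ∀ k, ∀ v ∈ U, (alphaBlock d h M ^ k).mulVec v ∈ U := by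
      intro k
      induction k with
      | zero => simp
      | succ k ih =>
        intro v hv
        rw [pow_succ, ← Matrix.mulVec_mulVec]
        exact ih _ (hα v hv)
    have hle : U ≤ LinearMap.ker (redKalman d h M).mulVecLin := fun v hv =>
      (mem_ker_redKalman_iff h M v).mpr fun k => by
        rw [← Matrix.mulVec_mulVec]
        exact hγ _ (hpow k v hv)
    have := Submodule.finrank_mono hle
    omega
  · intro hle
    obtain ⟨U, hUW, hU, hα⟩ := Module.End.exists_invariant_le_finrank_eq
      (alphaBlock d h M).mulVecLin (LinearMap.ker (redKalman d h M).mulVecLin)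
      (fun v hv => (mem_ker_redKalman_iff h M _).mpr fun k => by
        rw [Matrix.mulVecLin_apply, Matrix.mulVec_mulVec, Matrix.mul_assoc, ← pow_succ]
        exact (mem_ker_redKalman_iff h M v).mp hv (k + 1))
      (k := s) (by omega)
    refine ⟨U, hU, hα, fun v hv => ?_⟩
    simpa using (mem_ker_redKalman_iff h M v).mp (hUW hv) 0

theorem stmt2 (K : Type*) [Field K] [IsAlgClosed K] (n d s : ℕ)
    (hs : 1 ≤ s) (hsd : s ≤ d) (hdn : d < n) (M : Matrix (Fin n) (Fin n) K) :
    (M ∈ kalmanSet K n d s ↔ (redKalman d hdn.le M).rank ≤ d - s) ∧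
    (M ∈ kalmanSet K n d s ↔
      ∀ (r : Fin (d - s + 1) → Fin d × Fin (n - d)) (c : Fin (d - s + 1) → Fin d),
        Function.Injective r → Function.Injective c →
          ((redKalman d hdn.le M).submatrix r c).det = 0) := by
  have hmem := mem_kalmanSet_iff_rank_le hsd hdn.le M
  refine ⟨hmem, ?_⟩
  rw [hmem, ← Matrix.rank_lt_iff_forall_det_submatrix_eq_zero, Nat.lt_succ_iff]
end
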